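/- Let I be an index set of cardinality at most 2^{ℵ₀}, and for each i ∈ I let P_i be a σ-centered partial order with a greatest element 𝟙_i. Then the finite-support product P = ∏_{i∈I} P_i, consisting of all functions p with p(i) ∈ P_i for all i and p(i) = 𝟙_i for all but finitely many i, ordered coordinatewise, is σ-centered. -/

import Mathlib

/-- A subset `C` of a partial order is centered if every finite subset of `C`
has a lower bound in `P`. -/
def IsCentered {P : Type*} [PartialOrder P] (C : Set P) : Prop :=
  ∀ F : Finset P, ↑F ⊆ C → ∃ b : P, ∀ x ∈ F, b ≤ x

/-- `P` is σ-centered if it is the union of countably many centered subsets. -/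
def SigmaCentered (P : Type*) [PartialOrder P] : Prop :=
  ∃ Q : ℕ → Set P, (∀ n, IsCentered (Q n)) ∧ ∀ p : P, ∃ n, p ∈ Q n

/-- The finite-support product of a family of partial orders with greatest elements:
functions equal to the greatest element in all but finitely many coordinates. -/
def FinSuppProd {I : Type*} (P : I → Type*) [∀ i, PartialOrder (P i)]
    [∀ i, OrderTop (P i)] : Type _ :=
  {p : ∀ i, P i // {i | p i ≠ ⊤}.Finite}

/-- The finite-support product is ordered coordinatewise. -/
instance {I : Type*} (P : I → Type*) [∀ i, PartialOrder (P i)] [∀ i, OrderTop (P i)] :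
    PartialOrder (FinSuppProd P) :=
  inferInstanceAs (PartialOrder {p : ∀ i, P i // {i | p i ≠ ⊤}.Finite})

/-- Finitely many distinct sets of natural numbers are already distinguished by their
restrictions to some finite initial segment. -/
theorem exists_injOn_filter_range {I : Type*} {e : I → Set ℕ} (he : Function.Injective e)
    (S : Finset I) : ∃ N : ℕ, Set.InjOn
      (fun i => open Classical in (Finset.range N).filter (· ∈ e i)) (S : Set I) := by
  classical
  have hsep : ∀ i j, ∃ n, i ≠ j → ¬(n ∈ e i ↔ n ∈ e j) := by
    intro i j
    by_contra! hc
    exact (hc 0).1 (he (Set.ext fun n => (hc n).2))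
  choose d hd using hsep
  refine ⟨(S ×ˢ S).sup (fun x => d x.1 x.2) + 1, fun i hi j hj hij => ?_⟩
  by_contra hne
  have hlt : d i j ∈ Finset.range ((S ×ˢ S).sup (fun x => d x.1 x.2) + 1) :=
    Finset.mem_range.2 (Nat.lt_succ_of_le
      (Finset.le_sup (f := fun x : I × I => d x.1 x.2) (Finset.mk_mem_product hi hj)))
  refine hd i j hne ?_
  have := Finset.ext_iff.1 hij (d i j)
  simpa only [Finset.mem_filter, hlt, true_and] using this

/-- If `I` has at most the cardinality of the continuum, the product `ℕ ^ I` of discrete spaces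
is separable: some sequence of functions agrees on each finite set with any given function. -/
theorem exists_seq_forall_finset_eqOn {I : Type*} (hI : Cardinal.mk I ≤ Cardinal.continuum) :
    ∃ g : ℕ → I → ℕ, ∀ (S : Finset I) (f : I → ℕ), ∃ n, ∀ i ∈ S, g n i = f i := by
  classical
  obtain ⟨e⟩ : Nonempty (I ↪ Set ℕ) := by
    rw [← Cardinal.lift_mk_le']
    simpa using hI
  obtain ⟨u, hu⟩ := exists_surjective_nat (ℕ × (Finset ℕ →₀ ℕ))
  refine ⟨fun n i => (u n).2 ((Finset.range (u n).1).filter (· ∈ e i)), fun S f => ?_⟩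
  obtain ⟨N, hN⟩ := exists_injOn_filter_range e.injective S
  set key : I → Finset ℕ := fun i => (Finset.range N).filter (· ∈ e i)
  have hN' : Set.InjOn key S := by convert hN
  have hex : ∃ h : Finset ℕ →₀ ℕ, ∀ i ∈ S, h (key i) = f i := by
    rcases isEmpty_or_nonempty I with hE | hE
    · exact ⟨0, fun i => hE.elim i⟩
    refine ⟨Finsupp.onFinset (S.image key)
      (fun k => if k ∈ S.image key then f (Function.invFunOn key S k) else 0)
      (fun k hk => by by_contra hc; simp only [hc, if_false] at hk; exact hk rfl),
      fun i hi => ?_⟩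
    rw [Finsupp.onFinset_apply, if_pos (Finset.mem_image_of_mem key hi),
      hN'.leftInvOn_invFunOn hi]
  obtain ⟨h, hh⟩ := hex
  obtain ⟨n, hn⟩ := hu (N, h)
  refine ⟨n, fun i hi => ?_⟩
  simpa only [hn] using hh i hi

/-- The conditions of a finite-support product whose nontrivial coordinates lie in prescribed
centered sets form a centered set. -/
theorem isCentered_finSuppProd {I : Type*} (P : I → Type*) [∀ i, PartialOrder (P i)]
    [∀ i, OrderTop (P i)] {C : ∀ i, Set (P i)} (hC : ∀ i, IsCentered (C i)) :
    IsCentered {p : FinSuppProd P | ∀ i, p.1 i ≠ ⊤ → p.1 i ∈ C i} := by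
  classical
  intro F hF
  have hb : ∀ i, ∃ b : P i, (∀ p ∈ F, b ≤ p.1 i) ∧ ((∀ p ∈ F, p.1 i = ⊤) → b = ⊤) := by
    intro i
    by_cases ht : ∀ p ∈ F, p.1 i = ⊤
    · exact ⟨⊤, fun p hp => (ht p hp).ge, fun _ => rfl⟩
    obtain ⟨b, hb⟩ := hC i ((F.image fun p => p.1 i).filter (· ≠ ⊤)) (by
      intro x hx
      obtain ⟨hx, hne⟩ := Finset.mem_filter.1 hx
      obtain ⟨p, hp, rfl⟩ := Finset.mem_image.1 hx
      exact hF hp i hne)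
    refine ⟨b, fun p hp => ?_, fun h => absurd h ht⟩
    by_cases hpt : p.1 i = ⊤
    · exact hpt ▸ le_top
    · exact hb _ (Finset.mem_filter.2 ⟨Finset.mem_image_of_mem _ hp, hpt⟩)
  choose b hle htop using hb
  refine ⟨⟨b, (F.finite_toSet.biUnion fun p _ => p.2).subset fun i hi => ?_⟩,
    fun p hp i => hle i p hp⟩
  by_contra hc
  refine hi (htop i fun p hp => ?_)
  by_contra hpt
  exact hc (Set.mem_biUnion (Finset.mem_coe.2 hp) hpt)

/-- The finite-support product of at most continuum many σ-centered partial orders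
is σ-centered. -/
theorem finSuppProd_sigmaCentered {I : Type*} (P : I → Type*) [∀ i, PartialOrder (P i)]
    [∀ i, OrderTop (P i)] (hI : Cardinal.mk I ≤ Cardinal.continuum)
    (h : ∀ i, SigmaCentered (P i)) : SigmaCentered (FinSuppProd P) := by
  choose C hC hmem using h
  obtain ⟨g, hg⟩ := exists_seq_forall_finset_eqOn hI
  refine ⟨fun n => {p | ∀ i, p.1 i ≠ ⊤ → p.1 i ∈ C i (g n i)},
    fun n => isCentered_finSuppProd P fun i => hC i (g n i), fun p => ?_⟩
  choose f hf using fun i => hmem i (p.1 i)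
  obtain ⟨n, hn⟩ := hg p.2.toFinset f
  refine ⟨n, fun i hi => ?_⟩
  rw [hn i (p.2.mem_toFinset.2 hi)]
  exact hf i
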